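/- arXiv:1412.7002 — 2 statements merged into one kernel-verified Lean document; each statement's English description precedes it below -/
import Mathlib

section
/- Let d = 1 and b(x) = √|x|. Then for every locally bounded Borel measure ν on ℝ, the Cauchy problem ∂_t μ + ∂_x(b μ) = 0, μ|_{t=0} = ν has at most one solution in the class of all locally bounded (possibly signed) measures μ = μ_t dt on ℝ × [0,T] given by families of locally bounded measures (μ_t)_{t∈[0,T]} such that |μ_t|({0}) = 0 for almost all t ∈ [0,T]. -/
open MeasureTheory Metric Set Filter
open scoped Topology ENNReal

noncomputable section

/-- A family `(μ_t)_{t∈[0,T]}` of locally bounded signed Borel measures on `ℝ`,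
represented by its Jordan decomposition `μ_t = p t - n t`:  each `p t`, `n t` is
finite on compact sets and they are mutually singular, `t ↦ μ_t(B)` is measurable
for bounded Borel `B`, and `t ↦ |μ_t|(K)` is in `L¹[0,T]` for every compact `K`. -/
def IsLocFamily1 (T : ℝ) (p n : ℝ → Measure ℝ) : Prop :=
  (∀ t ∈ Icc (0:ℝ) T, ∀ K : Set ℝ, IsCompact K → p t K < ⊤ ∧ n t K < ⊤) ∧
  (∀ t ∈ Icc (0:ℝ) T, p t ⟂ₘ n t) ∧
  (∀ B : Set ℝ, MeasurableSet B → Bornology.IsBounded B →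
      Measurable (fun t => p t B) ∧ Measurable (fun t => n t B)) ∧
  (∀ K : Set ℝ, IsCompact K →
      IntegrableOn (fun t => (p t K).toReal + (n t K).toReal) (Icc (0:ℝ) T))

/-- Integral of `f` against the signed measure `μ_t = p t - n t`. -/
def sint1 (p n : ℝ → Measure ℝ) (t : ℝ) (f : ℝ → ℝ) : ℝ :=
  (∫ x, f x ∂(p t)) - ∫ x, f x ∂(n t)

/-- The family `μ_t = p t - n t` of signed measures on `ℝ` is a solution of the
Cauchy problem `∂_t μ + ∂_x (b μ) = 0`, `μ|_{t=0} = ν` (`ν = νp - νn`) on `[0,T]`: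
`b` is `|μ|`-integrable on `U × [0,T]` for every bounded interval `U` and the
weak identity `∫ u(x,t) μ_t(dx) = ∫ u(x,0) ν(dx) + ∫₀ᵗ ∫ [∂_t u + b ∂_x u] μ_s(dx) ds`
holds for a.e. `t ∈ [0,T]`, for every `C¹` test function `u` vanishing for
`|x| > R` for some `R`. -/
def IsSolution1 (T : ℝ) (b : ℝ → ℝ) (νp νn : Measure ℝ) (p n : ℝ → Measure ℝ) : Prop :=
  (∀ R : ℝ, 0 < R →
      (∫⁻ t in Icc (0:ℝ) T, ∫⁻ x in ball (0:ℝ) R, ENNReal.ofReal |b x| ∂(p t + n t)) < ⊤) ∧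
  ∀ u : ℝ → ℝ → ℝ,
    ContDiff ℝ 1 (fun q : ℝ × ℝ => u q.1 q.2) →
    (∃ R > 0, ∀ x t, R < |x| → u x t = 0) →
    ∀ᵐ t ∂(volume.restrict (Icc (0:ℝ) T)),
      sint1 p n t (fun x => u x t)
        = ((∫ x, u x 0 ∂νp) - ∫ x, u x 0 ∂νn)
          + ∫ s in Icc (0:ℝ) t,
              sint1 p n s (fun x => deriv (u x) s + b x * deriv (fun y => u y s) x)

/-- A smooth regularization, for `ε > 0`, of the signed square root `x ↦ x / √|x|`. -/
def signedRoot (ε x : ℝ) : ℝ := x / √√(x ^ 2 + ε)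

/-- The derivative of `signedRoot ε` for `ε > 0`. -/
def signedRootDeriv (ε x : ℝ) : ℝ := 1 / √√(x ^ 2 + ε) - x ^ 2 / (2 * √√(x ^ 2 + ε) ^ 5)

lemma sqrt_sqrt_pos {ε : ℝ} (hε : 0 < ε) (x : ℝ) : 0 < √√(x ^ 2 + ε) := by positivity

lemma sqrt_sqrt_pow_four {ε : ℝ} (hε : 0 ≤ ε) (x : ℝ) : √√(x ^ 2 + ε) ^ 4 = x ^ 2 + ε := by
  rw [show 4 = 2 * 2 from rfl, pow_mul, Real.sq_sqrt (by positivity), Real.sq_sqrt (by positivity)]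

lemma sqrt_abs_pow_four (x : ℝ) : √|x| ^ 4 = x ^ 2 := by
  rw [show 4 = 2 * 2 from rfl, pow_mul, Real.sq_sqrt (by positivity), sq_abs]

lemma sqrt_sqrt_sq (x : ℝ) : √√(x ^ 2 + 0) = √|x| := by
  rw [add_zero, Real.sqrt_sq_eq_abs]

lemma contDiff_signedRoot {ε : ℝ} (hε : 0 < ε) : ContDiff ℝ 1 (signedRoot ε) := by
  unfold signedRoot
  refine ContDiff.div (by fun_prop) ?_ fun x => (sqrt_sqrt_pos hε x).ne'
  refine ContDiff.sqrt (ContDiff.sqrt (by fun_prop) fun x => ?_) fun x => ?_ <;> positivity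

lemma measurable_signedRoot (ε : ℝ) : Measurable (signedRoot ε) := by
  unfold signedRoot; fun_prop

lemma hasDerivAt_signedRoot {ε : ℝ} (hε : 0 < ε) (x : ℝ) :
    HasDerivAt (signedRoot ε) (signedRootDeriv ε x) x := by
  have hq := sqrt_sqrt_pos hε x
  have h1 : HasDerivAt (fun x : ℝ => x ^ 2 + ε) (2 * x) x := by
    simpa using (hasDerivAt_pow 2 x).add_const ε
  have h2 := (h1.sqrt (by positivity)).sqrt (by positivity)
  have h3 := (hasDerivAt_id x).div h2 hq.ne'
  refine (show HasDerivAt (signedRoot ε) _ x from h3).congr_deriv ?_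
  have hs : √(x ^ 2 + ε) = √√(x ^ 2 + ε) ^ 2 := (Real.sq_sqrt (by positivity)).symm
  simp only [signedRootDeriv, id]
  generalize √√(x ^ 2 + ε) = q at hq hs ⊢
  rw [hs]
  field_simp

lemma measurable_signedRootDeriv (ε : ℝ) : Measurable (signedRootDeriv ε) := by
  unfold signedRootDeriv; fun_prop

lemma sqrt_abs_mul_signedRootDeriv {ε : ℝ} (hε : 0 < ε) (x : ℝ) :
    √|x| * signedRootDeriv ε x =
      √|x| / √√(x ^ 2 + ε) - (√|x| / √√(x ^ 2 + ε)) ^ 5 / 2 := by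
  have hq := sqrt_sqrt_pos hε x
  rw [signedRootDeriv, ← sqrt_abs_pow_four]
  field_simp

lemma sqrt_abs_div_le_one {ε : ℝ} (hε : 0 < ε) (x : ℝ) : √|x| / √√(x ^ 2 + ε) ≤ 1 := by
  refine div_le_one_of_le₀ ?_ (by positivity)
  rw [← sqrt_sqrt_sq]
  gcongr

lemma abs_sqrt_abs_mul_signedRootDeriv_sub_le {ε : ℝ} (hε : 0 < ε) (x : ℝ) :
    |√|x| * signedRootDeriv ε x - 1 / 2| ≤ 1 := by
  rw [sqrt_abs_mul_signedRootDeriv hε]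
  have h1 := sqrt_abs_div_le_one hε x
  have h0 : 0 ≤ √|x| / √√(x ^ 2 + ε) := by positivity
  generalize √|x| / √√(x ^ 2 + ε) = r at h0 h1
  have h5 : r ^ 5 ≤ 1 := pow_le_one₀ h0 h1
  have h6 : 0 ≤ r ^ 5 := by positivity
  rw [abs_le]
  constructor <;> linarith

lemma tendsto_sqrt_sqrt {ε : ℕ → ℝ} (h : Tendsto ε atTop (𝓝 0)) (x : ℝ) :
    Tendsto (fun j => √√(x ^ 2 + ε j)) atTop (𝓝 √|x|) := by
  rw [← sqrt_sqrt_sq]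
  exact ((tendsto_const_nhds.add h).sqrt).sqrt

lemma tendsto_signedRoot {ε : ℕ → ℝ} (h : Tendsto ε atTop (𝓝 0)) (x : ℝ) :
    Tendsto (fun j => signedRoot (ε j) x) atTop (𝓝 (signedRoot 0 x)) := by
  rcases eq_or_ne x 0 with rfl | hx
  · simp [signedRoot]
  · unfold signedRoot
    rw [sqrt_sqrt_sq]
    exact tendsto_const_nhds.div (tendsto_sqrt_sqrt h x) (by positivity)

lemma tendsto_sqrt_abs_mul_signedRootDeriv {ε : ℕ → ℝ} (hε : ∀ j, 0 < ε j)
    (h : Tendsto ε atTop (𝓝 0)) {x : ℝ} (hx : x ≠ 0) :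
    Tendsto (fun j => √|x| * signedRootDeriv (ε j) x) atTop (𝓝 (1 / 2)) := by
  have h1 : Tendsto (fun j => √|x| / √√(x ^ 2 + ε j)) atTop (𝓝 1) := by
    have := (tendsto_const_nhds (x := √|x|)).div (tendsto_sqrt_sqrt h x) (by positivity)
    rwa [div_self (by positivity)] at this
  simp_rw [fun j => sqrt_abs_mul_signedRootDeriv (hε j) x]
  convert h1.sub ((h1.pow 5).div_const 2) using 2
  norm_num

lemma sqrt_abs_le_two_mul_abs_signedRoot {ε : ℝ} (h0 : 0 ≤ ε) (h1 : ε ≤ 1) {x : ℝ}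
    (hx : 1 ≤ |x|) : √|x| ≤ 2 * |signedRoot ε x| := by
  have ha : 0 < √|x| := by positivity
  have hq4 := sqrt_sqrt_pow_four h0 x
  have ha4 := sqrt_abs_pow_four x
  have hx2 : 1 ≤ x ^ 2 := by rw [← sq_abs]; exact one_le_pow₀ hx
  have hq : 0 < √√(x ^ 2 + ε) := by positivity
  have hle : √√(x ^ 2 + ε) ≤ 2 * √|x| := by
    refine le_of_pow_le_pow_left₀ (n := 4) (by norm_num) (by positivity) ?_
    rw [hq4, mul_pow, ha4]; linarith
  rw [signedRoot, abs_div, abs_of_pos hq, mul_div_assoc', le_div_iff₀ hq]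
  have := Real.mul_self_sqrt (abs_nonneg x)
  nlinarith

lemma signedRoot_zero_mul_abs (x : ℝ) : signedRoot 0 x * |signedRoot 0 x| = x := by
  rw [signedRoot, sqrt_sqrt_sq]
  rcases eq_or_ne x 0 with rfl | hx
  · simp
  · rw [abs_div, abs_of_nonneg (Real.sqrt_nonneg _), div_mul_div_comm,
      Real.mul_self_sqrt (abs_nonneg x)]
    have : |x| ≠ 0 := by positivity
    field_simp

lemma exists_radius_lt_abs_signedRoot_sub (A S : ℝ) :
    ∃ R > 0, ∀ ε x s : ℝ, 0 ≤ ε → ε ≤ 1 → |s| ≤ S → R < |x| → A < |signedRoot ε x - s| := by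
  refine ⟨1 + (2 * (A + S)) ^ 2, by positivity, fun ε x s h0 h1 hs hx => ?_⟩
  have h2 : 2 * (A + S) < √|x| := Real.lt_sqrt_of_sq_lt (by linarith)
  have h3 := sqrt_abs_le_two_mul_abs_signedRoot h0 h1 (x := x) (by nlinarith)
  have h4 := abs_sub_abs_le_abs_sub (signedRoot ε x) s
  linarith

section Limits

variable {φ : ℝ → ℝ} {A : ℝ}

lemma exists_abs_le_of_vanishing (hφ : Continuous φ) (hA : ∀ w, A < |w| → φ w = 0) :
    ∃ C, ∀ w, |φ w| ≤ C := by
  have : HasCompactSupport φ := HasCompactSupport.intro (isCompact_closedBall (0 : ℝ) A)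
    fun w hw => hA w (by simpa using hw)
  exact this.exists_bound_of_continuous hφ

lemma exists_integrable_bound_comp_signedRoot {m : Measure ℝ}
    (hm : ∀ K : Set ℝ, IsCompact K → m K < ⊤) (hφ : Continuous φ)
    (hA : ∀ w, A < |w| → φ w = 0) (s : ℝ) :
    ∃ g : ℝ → ℝ, Integrable g m ∧
      ∀ ε x, 0 ≤ ε → ε ≤ 1 → ‖φ (signedRoot ε x - s)‖ ≤ g x := by
  obtain ⟨C, hC⟩ := exists_abs_le_of_vanishing hφ hA
  obtain ⟨R, -, hR⟩ := exists_radius_lt_abs_signedRoot_sub A |s|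
  refine ⟨(closedBall 0 R).indicator fun _ => C, ?_, fun ε x h0 h1 => ?_⟩
  · rw [integrable_indicator_iff measurableSet_closedBall]
    exact integrableOn_const (hm _ (isCompact_closedBall _ _)).ne
  · by_cases hx : x ∈ closedBall (0 : ℝ) R
    · rw [indicator_of_mem hx]; exact hC _
    · rw [indicator_of_notMem hx, hA _ (hR ε x s h0 h1 le_rfl (by simpa using hx)), norm_zero]

lemma integrable_comp_signedRoot {m : Measure ℝ}
    (hm : ∀ K : Set ℝ, IsCompact K → m K < ⊤) (hφ : Continuous φ)
    (hA : ∀ w, A < |w| → φ w = 0) (s : ℝ) {ε : ℝ} (h0 : 0 ≤ ε) (h1 : ε ≤ 1) :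
    Integrable (fun x => φ (signedRoot ε x - s)) m := by
  obtain ⟨g, hg, hb⟩ := exists_integrable_bound_comp_signedRoot hm hφ hA s
  exact hg.mono' (hφ.measurable.comp
    ((measurable_signedRoot ε).sub_const s)).aestronglyMeasurable (ae_of_all _ fun x => hb ε x h0 h1)

lemma tendsto_integral_comp_signedRoot {m : Measure ℝ}
    (hm : ∀ K : Set ℝ, IsCompact K → m K < ⊤) (hφ : Continuous φ)
    (hA : ∀ w, A < |w| → φ w = 0) (s : ℝ) {ε : ℕ → ℝ} (h0 : ∀ j, 0 ≤ ε j)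
    (h1 : ∀ j, ε j ≤ 1) (hε : Tendsto ε atTop (𝓝 0)) :
    Tendsto (fun j => ∫ x, φ (signedRoot (ε j) x - s) ∂m) atTop
      (𝓝 (∫ x, φ (signedRoot 0 x - s) ∂m)) := by
  obtain ⟨g, hg, hb⟩ := exists_integrable_bound_comp_signedRoot hm hφ hA s
  exact tendsto_integral_of_dominated_convergence g
    (fun j => (hφ.measurable.comp
      ((measurable_signedRoot (ε j)).sub_const s)).aestronglyMeasurable) hg
    (fun j => ae_of_all _ fun x => hb (ε j) x (h0 j) (h1 j))
    (ae_of_all _ fun x => (hφ.tendsto _).comp ((tendsto_signedRoot hε x).sub_const s))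

end Limits

lemma enorm_sint1_le (p n : ℝ → Measure ℝ) (t : ℝ) (f : ℝ → ℝ) :
    ‖sint1 p n t f‖ₑ ≤ ∫⁻ x, ‖f x‖ₑ ∂(p t + n t) := by
  rw [lintegral_add_measure]
  exact enorm_sub_le.trans
    (add_le_add (enorm_integral_le_lintegral_enorm _) (enorm_integral_le_lintegral_enorm _))

namespace IsLocFamily1

variable {T : ℝ} {p n : ℝ → Measure ℝ}

lemma measurable_restrict (h : IsLocFamily1 T p n) {K : Set ℝ} (hK : MeasurableSet K)
    (hb : Bornology.IsBounded K) : Measurable fun t => (p t + n t).restrict K := by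
  refine Measure.measurable_of_measurable_coe _ fun B hB => ?_
  simp only [Measure.restrict_apply hB, Measure.add_apply]
  have := h.2.2.1 (B ∩ K) (hB.inter hK) (hb.subset inter_subset_right)
  exact this.1.add this.2

lemma apply_lt_top (h : IsLocFamily1 T p n) {t : ℝ} (ht : t ∈ Icc 0 T) {K : Set ℝ}
    (hK : IsCompact K) : (p t + n t) K < ⊤ := by
  have := h.1 t ht K hK
  exact ENNReal.add_lt_top.2 this

lemma lintegral_apply_lt_top (h : IsLocFamily1 T p n) {K : Set ℝ} (hK : IsCompact K) :
    ∫⁻ t in Icc 0 T, (p t + n t) K < ⊤ := by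
  refine lt_of_le_of_lt (le_of_eq ?_) (h.2.2.2 K hK).2
  refine setLIntegral_congr_fun measurableSet_Icc fun t ht => ?_
  have := h.1 t ht K hK
  rw [Real.enorm_of_nonneg (by positivity), ENNReal.ofReal_add (by positivity) (by positivity),
    ENNReal.ofReal_toReal this.1.ne, ENNReal.ofReal_toReal this.2.ne, Measure.add_apply]

/-- The commutator produced by the regularized coordinate tends to zero, because the measures
do not charge the origin. -/
lemma tendsto_lintegral_defect (h : IsLocFamily1 T p n)
    (h0 : ∀ᵐ t ∂(volume.restrict (Icc (0 : ℝ) T)), (p t + n t) {0} = 0) (R : ℝ)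
    {ε : ℕ → ℝ} (hpos : ∀ j, 0 < ε j) (hε : Tendsto ε atTop (𝓝 0)) :
    Tendsto (fun j => ∫⁻ s in Icc 0 T, ∫⁻ x in closedBall 0 R,
      ‖√|x| * signedRootDeriv (ε j) x - 1 / 2‖ₑ ∂(p s + n s)) atTop (𝓝 0) := by
  have hmeas : ∀ j, Measurable fun x => ‖√|x| * signedRootDeriv (ε j) x - 1 / 2‖ₑ := fun j =>
    ((Measurable.mul (by fun_prop) (measurable_signedRootDeriv _)).sub_const _).enorm
  have hle : ∀ j x, ‖√|x| * signedRootDeriv (ε j) x - 1 / 2‖ₑ ≤ 1 := fun j x => by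
    rw [Real.enorm_eq_ofReal_abs]
    exact ENNReal.ofReal_le_one.2 (abs_sqrt_abs_mul_signedRootDeriv_sub_le (hpos j) x)
  rw [← lintegral_zero (μ := volume.restrict (Icc (0 : ℝ) T))]
  refine tendsto_lintegral_of_dominated_convergence (fun s => (p s + n s) (closedBall 0 R))
    (fun j => (Measure.measurable_lintegral (hmeas j)).comp
      (h.measurable_restrict measurableSet_closedBall isBounded_closedBall))
    (fun j => ae_of_all _ fun s => ?_)
    (h.lintegral_apply_lt_top (isCompact_closedBall _ _)).ne ?_
  · exact (lintegral_mono (hle j)).trans (by simp)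
  · filter_upwards [h0, ae_restrict_mem measurableSet_Icc] with s hs hsT
    rw [← lintegral_zero (μ := (p s + n s).restrict (closedBall 0 R))]
    refine tendsto_lintegral_of_dominated_convergence (fun _ => 1) hmeas
      (fun j => ae_of_all _ (hle j)) ?_ ?_
    · simpa using (h.apply_lt_top hsT (isCompact_closedBall (0 : ℝ) R)).ne
    · have : ∀ᵐ x ∂(p s + n s), x ≠ 0 := by
        rw [ae_iff]; simpa using hs
      filter_upwards [ae_restrict_of_ae this] with x hx
      rw [← tendsto_zero_iff_enorm_tendsto_zero]
      simpa using (tendsto_sqrt_abs_mul_signedRootDeriv hpos hε hx).sub_const (1 / 2)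

end IsLocFamily1

/-- Along the characteristics `signedRoot 0 x - t / 2 = const`, a solution not charging the origin
is constant in time. -/
lemma IsSolution1.ae_sint1_eq {T : ℝ} (hT : 0 < T) {νp νn : Measure ℝ}
    (hν : ∀ K : Set ℝ, IsCompact K → νp K < ⊤ ∧ νn K < ⊤) {p n : ℝ → Measure ℝ}
    (hfam : IsLocFamily1 T p n) (hsol : IsSolution1 T (fun x => √|x|) νp νn p n)
    (h0 : ∀ᵐ t ∂(volume.restrict (Icc (0 : ℝ) T)), (p t + n t) {0} = 0)
    {φ : ℝ → ℝ} {A : ℝ} (hφ : ContDiff ℝ 1 φ) (hA : ∀ w, A < |w| → φ w = 0) :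
    ∀ᵐ t ∂(volume.restrict (Icc (0 : ℝ) T)),
      sint1 p n t (fun x => φ (signedRoot 0 x - t / 2)) =
        (∫ x, φ (signedRoot 0 x - 0 / 2) ∂νp) - ∫ x, φ (signedRoot 0 x - 0 / 2) ∂νn := by
  obtain ⟨ε, -, hεpos, hε⟩ := exists_seq_strictAnti_tendsto' (show (0 : ℝ) < 1 by norm_num)
  have hpos : ∀ j, 0 < ε j := fun j => (hεpos j).1
  have hone : ∀ j, ε j ≤ 1 := fun j => (hεpos j).2.le
  have hA' : ∀ w, A < |w| → deriv φ w = 0 := fun w hw => by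
    have : φ =ᶠ[𝓝 w] fun _ => 0 := by
      filter_upwards [(isOpen_lt continuous_const continuous_abs).mem_nhds hw] with v hv
      exact hA v hv
    rw [this.deriv_eq, deriv_const]
  obtain ⟨M, hM⟩ := exists_abs_le_of_vanishing (hφ.continuous_deriv le_rfl) hA'
  obtain ⟨R, hR0, hR⟩ := exists_radius_lt_abs_signedRoot_sub A (3 * T / 2)
  let χ : ContDiffBump (T / 2) := ⟨T, 2 * T, hT, by linarith⟩
  have hχ : ∀ t ∈ Icc (0 : ℝ) T, χ =ᶠ[𝓝 t] 1 := fun t ht => by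
    refine χ.eventuallyEq_one_of_mem_ball ?_
    rw [Metric.mem_ball, Real.dist_eq, abs_lt]
    constructor <;> linarith [ht.1, ht.2, show χ.rIn = T from rfl]
  have hχ1 : ∀ t ∈ Icc (0 : ℝ) T, χ t = 1 := fun t ht => (hχ t ht).eq_of_nhds
  let u : ℕ → ℝ → ℝ → ℝ := fun j x t => χ t * φ (signedRoot (ε j) x - t / 2)
  have hu : ∀ j, ContDiff ℝ 1 (fun q : ℝ × ℝ => u j q.1 q.2) := fun j => by
    refine ContDiff.mul (χ.contDiff.comp contDiff_snd) (hφ.comp ?_)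
    exact ((contDiff_signedRoot (hpos j)).comp contDiff_fst).sub (contDiff_snd.div_const 2)
  have hsupp : ∀ j x t, R < |x| → u j x t = 0 := fun j x t hx => by
    by_cases ht : χ.rOut ≤ dist t (T / 2)
    · simp only [u, χ.zero_of_le_dist ht, zero_mul]
    · rw [not_le, Real.dist_eq, abs_lt, show χ.rOut = 2 * T from rfl] at ht
      refine mul_eq_zero_of_right _ (hA _ (hR _ _ _ (hpos j).le (hone j) ?_ hx))
      rw [abs_le]
      constructor <;> linarith [ht.1, ht.2]
  have hderiv : ∀ j x, ∀ s ∈ Icc (0 : ℝ) T,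
      deriv (u j x) s + √|x| * deriv (fun y => u j y s) x =
        deriv φ (signedRoot (ε j) x - s / 2) * (√|x| * signedRootDeriv (ε j) x - 1 / 2) := by
    intro j x s hs
    have hd := (hφ.differentiable one_ne_zero (signedRoot (ε j) x - s / 2)).hasDerivAt
    have h1 : deriv (u j x) s = deriv φ (signedRoot (ε j) x - s / 2) * (-(1 / 2)) := by
      have : u j x =ᶠ[𝓝 s] fun t => φ (signedRoot (ε j) x - t / 2) := by
        filter_upwards [hχ s hs] with t ht
        simp [u, ht]
      rw [this.deriv_eq]
      exact (hd.comp s (((hasDerivAt_id s).div_const 2).const_sub _)).deriv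
    have h2 : deriv (fun y => u j y s) x =
        deriv φ (signedRoot (ε j) x - s / 2) * signedRootDeriv (ε j) x := by
      simp only [u, hχ1 s hs, one_mul]
      exact (hd.comp x ((hasDerivAt_signedRoot (hpos j) x).sub_const _)).deriv
    rw [h1, h2]
    ring
  have hall := ae_all_iff.2 fun j => hsol.2 (u j) (hu j) ⟨R, hR0, hsupp j⟩
  filter_upwards [hall, ae_restrict_mem measurableSet_Icc] with t ht htT
  have hl : Tendsto (fun j => sint1 p n t (fun x => u j x t)) atTop
      (𝓝 (sint1 p n t (fun x => φ (signedRoot 0 x - t / 2)))) := by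
    simp only [u, hχ1 t htT, one_mul]
    exact (tendsto_integral_comp_signedRoot (fun K hK => (hfam.1 t htT K hK).1) hφ.continuous
      hA _ (fun j => (hpos j).le) hone hε).sub
      (tendsto_integral_comp_signedRoot (fun K hK => (hfam.1 t htT K hK).2) hφ.continuous
      hA _ (fun j => (hpos j).le) hone hε)
  have hc : Tendsto (fun j => (∫ x, u j x 0 ∂νp) - ∫ x, u j x 0 ∂νn) atTop
      (𝓝 ((∫ x, φ (signedRoot 0 x - 0 / 2) ∂νp) - ∫ x, φ (signedRoot 0 x - 0 / 2) ∂νn)) := by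
    simp only [u, hχ1 0 ⟨le_rfl, hT.le⟩, one_mul]
    exact (tendsto_integral_comp_signedRoot (fun K hK => (hν K hK).1) hφ.continuous
      hA _ (fun j => (hpos j).le) hone hε).sub
      (tendsto_integral_comp_signedRoot (fun K hK => (hν K hK).2) hφ.continuous
      hA _ (fun j => (hpos j).le) hone hε)
  have hr : Tendsto (fun j => ∫ s in Icc (0 : ℝ) t, sint1 p n s
      (fun x => deriv (u j x) s + √|x| * deriv (fun y => u j y s) x)) atTop (𝓝 0) := by
    rw [tendsto_zero_iff_enorm_tendsto_zero]
    have hlim := ENNReal.Tendsto.const_mul (a := ENNReal.ofReal M)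
      (hfam.tendsto_lintegral_defect h0 R hpos hε) (Or.inr ENNReal.ofReal_ne_top)
    rw [mul_zero] at hlim
    refine tendsto_of_tendsto_of_tendsto_of_le_of_le tendsto_const_nhds hlim
      (fun _ => zero_le) fun j => ?_
    refine (enorm_integral_le_lintegral_enorm _).trans
      ((lintegral_mono_set (Icc_subset_Icc_right htT.2)).trans ?_)
    rw [← lintegral_const_mul' _ _ ENNReal.ofReal_ne_top]
    refine setLIntegral_mono' measurableSet_Icc fun s hs => (enorm_sint1_le p n s _).trans ?_
    rw [← lintegral_const_mul' _ _ ENNReal.ofReal_ne_top,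
      ← lintegral_indicator measurableSet_closedBall]
    refine lintegral_mono fun x => ?_
    dsimp only
    rw [hderiv j x s hs]
    by_cases hx : x ∈ closedBall (0 : ℝ) R
    · rw [indicator_of_mem hx, enorm_mul, Real.enorm_eq_ofReal_abs (deriv φ _)]
      gcongr
      exact hM _
    · rw [hA' _ (hR _ _ _ (hpos j).le (hone j) ?_ (by simpa using hx)), zero_mul, enorm_zero]
      · exact zero_le
      · rw [abs_le]
        constructor <;> linarith [hs.1, hs.2]
  have hrhs := hc.add hr
  rw [add_zero] at hrhs
  exact tendsto_nhds_unique hl (hrhs.congr fun j => (ht j).symm)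

/-- Smooth functions increasing to the indicator of `Ioo a b`. -/
lemma exists_seq_contDiff_tendsto_indicator_Ioo {a b : ℝ} (hab : a < b) :
    ∃ φ : ℕ → ℝ → ℝ, (∀ k, ContDiff ℝ 1 (φ k)) ∧ (∀ k w, w ∉ Ioo a b → φ k w = 0) ∧
      (∀ k w, ‖φ k w‖ ≤ 1) ∧
      ∀ w, Tendsto (fun k => φ k w) atTop (𝓝 ((Ioo a b).indicator (fun _ => 1) w)) := by
  obtain ⟨r, -, hr, hlim⟩ := exists_seq_strictMono_tendsto' (show 0 < (b - a) / 2 by linarith)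
  let f : ∀ _ : ℕ, ContDiffBump ((a + b) / 2) := fun k => ⟨r k, (b - a) / 2, (hr k).1, (hr k).2⟩
  have hball : Ioo a b = ball ((a + b) / 2) ((b - a) / 2) := Real.Ioo_eq_ball a b
  have hzero : ∀ k w, w ∉ Ioo a b → f k w = 0 := fun k w hw =>
    (f k).zero_of_le_dist (by simpa [hball] using hw)
  refine ⟨fun k => f k, fun k => (f k).contDiff, hzero, fun k w => ?_, fun w => ?_⟩
  · rw [Real.norm_of_nonneg (f k).nonneg]
    exact (f k).le_one
  · by_cases hw : w ∈ Ioo a b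
    · rw [indicator_of_mem hw]
      refine tendsto_const_nhds.congr' ?_
      rw [hball, Metric.mem_ball] at hw
      filter_upwards [hlim.eventually_const_le hw] with k hk
      exact ((f k).one_of_mem_closedBall hk).symm
    · simp only [indicator_of_notMem hw, hzero _ w hw, tendsto_const_nhds]

/-- A locally finite measure is determined by the integrals of the functions
`x ↦ φ a b k (signedRoot 0 x - s)`, where `φ a b k` tends to the indicator of `Ioo a b`. -/
lemma measure_ext_of_integral_comp_signedRoot {m m' : Measure ℝ}
    (hm : ∀ K : Set ℝ, IsCompact K → m K < ⊤) (hm' : ∀ K : Set ℝ, IsCompact K → m' K < ⊤) (s : ℝ)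
    (φ : ℚ → ℚ → ℕ → ℝ → ℝ) (hc : ∀ a b k, ContDiff ℝ 1 (φ a b k))
    (hz : ∀ a b : ℚ, a < b → ∀ k w, w ∉ Ioo (a : ℝ) b → φ a b k w = 0)
    (hn : ∀ a b : ℚ, a < b → ∀ k w, ‖φ a b k w‖ ≤ 1)
    (hl : ∀ a b : ℚ, a < b → ∀ w,
      Tendsto (fun k => φ a b k w) atTop (𝓝 ((Ioo (a : ℝ) b).indicator (fun _ => 1) w)))
    (h : ∀ a b : ℚ, a < b → ∀ k,
      ∫ x, φ a b k (signedRoot 0 x - s) ∂m = ∫ x, φ a b k (signedRoot 0 x - s) ∂m') :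
    m = m' := by
  have hY : Measurable fun x => signedRoot 0 x - s := (measurable_signedRoot 0).sub_const s
  have hfin : ∀ {m : Measure ℝ}, (∀ K : Set ℝ, IsCompact K → m K < ⊤) → ∀ S : Set ℝ,
      MeasurableSet S → Bornology.IsBounded S → m.map (fun x => signedRoot 0 x - s) S < ⊤ := by
    intro m hm S hS hb
    obtain ⟨A, hA⟩ := hb.exists_norm_le
    obtain ⟨R, -, hR⟩ := exists_radius_lt_abs_signedRoot_sub A |s|
    rw [Measure.map_apply hY hS]
    refine (measure_mono fun x hx => ?_).trans_lt (hm _ (isCompact_closedBall (0 : ℝ) R))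
    by_contra hxR
    exact (hR 0 x s le_rfl zero_le_one le_rfl (by simpa using hxR)).not_ge (hA _ hx)
  have hlf : ∀ {m : Measure ℝ}, (∀ K : Set ℝ, IsCompact K → m K < ⊤) →
      IsLocallyFiniteMeasure (m.map fun x => signedRoot 0 x - s) := fun hm =>
    have : IsFiniteMeasureOnCompacts (Measure.map (fun x => signedRoot 0 x - s) _) :=
      ⟨fun {K} hK => hfin hm K hK.measurableSet hK.isBounded⟩
    isLocallyFiniteMeasure_of_isFiniteMeasureOnCompacts
  have hint : ∀ {m : Measure ℝ}, (∀ K : Set ℝ, IsCompact K → m K < ⊤) → ∀ a b : ℚ, a < b →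
      Tendsto (fun k => ∫ x, φ a b k (signedRoot 0 x - s) ∂m) atTop
        (𝓝 ((m.map fun x => signedRoot 0 x - s).real (Ioo (a : ℝ) b))) := by
    intro m hm a b hab
    simp_rw [fun k => (integral_map (μ := m) hY.aemeasurable
      (hc a b k).continuous.aestronglyMeasurable).symm]
    rw [← integral_indicator_one measurableSet_Ioo]
    refine tendsto_integral_of_dominated_convergence ((Ioo (a : ℝ) b).indicator fun _ => 1)
      (fun k => (hc a b k).continuous.aestronglyMeasurable) ?_
      (fun k => ae_of_all _ fun w => ?_) (ae_of_all _ fun w => hl a b hab w)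
    · rw [integrable_indicator_iff measurableSet_Ioo]
      exact integrableOn_const (hfin hm _ measurableSet_Ioo (isBounded_Ioo _ _)).ne
    · by_cases hw : w ∈ Ioo (a : ℝ) b
      · rw [indicator_of_mem hw]; exact hn a b hab k w
      · rw [indicator_of_notMem hw, hz a b hab k w hw, norm_zero]
  have hmap : m.map (fun x => signedRoot 0 x - s) = m'.map fun x => signedRoot 0 x - s := by
    have := hlf hm
    refine Real.measure_ext_Ioo_rat fun a b => ?_
    rcases lt_or_ge a b with hab | hab
    · rw [← measureReal_eq_measureReal_iff (hfin hm _ measurableSet_Ioo (isBounded_Ioo _ _)).ne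
        (hfin hm' _ measurableSet_Ioo (isBounded_Ioo _ _)).ne]
      exact tendsto_nhds_unique (hint hm a b hab) ((hint hm' a b hab).congr fun k =>
        (h a b hab k).symm)
    · rw [Ioo_eq_empty (by exact_mod_cast hab.not_gt), measure_empty, measure_empty]
  have hZ : Measurable fun w : ℝ => (w + s) * |w + s| := by fun_prop
  have hid : (fun w : ℝ => (w + s) * |w + s|) ∘ (fun x => signedRoot 0 x - s) = id := by
    funext x
    simpa using signedRoot_zero_mul_abs x
  have := congrArg (Measure.map fun w : ℝ => (w + s) * |w + s|) hmap
  rwa [Measure.map_map hZ hY, Measure.map_map hZ hY, hid, Measure.map_id, Measure.map_id] at this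

/-- **Uniqueness class for `b(x) = √|x|`.** For every locally bounded Borel
measure `ν` on `ℝ`, the Cauchy problem `∂_t μ + ∂_x (√|x| μ) = 0`,
`μ|_{t=0} = ν` has at most one solution among locally bounded (possibly signed)
measures `μ = μ_t dt` given by families `(μ_t)_{t∈[0,T]}` with
`|μ_t|({0}) = 0` for a.e. `t ∈ [0,T]`. -/
theorem uniqueness_sqrt_drift
    (T : ℝ) (hT : 0 < T)
    (νp νn : Measure ℝ) (hν : ∀ K : Set ℝ, IsCompact K → νp K < ⊤ ∧ νn K < ⊤)
    (p₁ n₁ p₂ n₂ : ℝ → Measure ℝ)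
    (hfam₁ : IsLocFamily1 T p₁ n₁) (hfam₂ : IsLocFamily1 T p₂ n₂)
    (hsol₁ : IsSolution1 T (fun x => Real.sqrt |x|) νp νn p₁ n₁)
    (hsol₂ : IsSolution1 T (fun x => Real.sqrt |x|) νp νn p₂ n₂)
    (h0₁ : ∀ᵐ t ∂(volume.restrict (Icc (0:ℝ) T)), (p₁ t + n₁ t) {0} = 0)
    (h0₂ : ∀ᵐ t ∂(volume.restrict (Icc (0:ℝ) T)), (p₂ t + n₂ t) {0} = 0) :
    ∀ᵐ t ∂(volume.restrict (Icc (0:ℝ) T)), p₁ t + n₂ t = p₂ t + n₁ t := by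
  have hex : ∀ a b : ℚ, ∃ φ : ℕ → ℝ → ℝ, (∀ k, ContDiff ℝ 1 (φ k)) ∧ (a < b →
      (∀ k w, w ∉ Ioo (a : ℝ) b → φ k w = 0) ∧ (∀ k w, ‖φ k w‖ ≤ 1) ∧
      ∀ w, Tendsto (fun k => φ k w) atTop (𝓝 ((Ioo (a : ℝ) b).indicator (fun _ => 1) w))) := by
    intro a b
    by_cases hab : a < b
    · obtain ⟨φ, h1, h2⟩ := exists_seq_contDiff_tendsto_indicator_Ioo
        (show (a : ℝ) < b by exact_mod_cast hab)
      exact ⟨φ, h1, fun _ => h2⟩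
    · exact ⟨fun _ _ => 0, fun _ => contDiff_const, fun h => absurd h hab⟩
  choose φ hc hφ using hex
  have hvan : ∀ a b : ℚ, a < b → ∀ k w, |(a : ℝ)| + |(b : ℝ)| < |w| → φ a b k w = 0 := by
    refine fun a b hab k w hw => (hφ a b hab).1 k w fun hmem => hw.not_ge ?_
    rw [abs_le]
    constructor <;>
      linarith [hmem.1, hmem.2, neg_abs_le (a : ℝ), le_abs_self (b : ℝ), abs_nonneg (a : ℝ),
        abs_nonneg (b : ℝ)]
  have hae : ∀ a b : ℚ, ∀ k, ∀ᵐ t ∂(volume.restrict (Icc (0 : ℝ) T)), a < b →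
      sint1 p₁ n₁ t (fun x => φ a b k (signedRoot 0 x - t / 2)) =
        sint1 p₂ n₂ t (fun x => φ a b k (signedRoot 0 x - t / 2)) := by
    intro a b k
    by_cases hab : a < b
    · filter_upwards [hsol₁.ae_sint1_eq hT hν hfam₁ h0₁ (hc a b k) (hvan a b hab k),
        hsol₂.ae_sint1_eq hT hν hfam₂ h0₂ (hc a b k) (hvan a b hab k)]
        with t h1 h2 _
      rw [h1, h2]
    · exact ae_of_all _ fun _ h => absurd h hab
  filter_upwards [ae_all_iff.2 fun a => ae_all_iff.2 fun b => ae_all_iff.2 (hae a b),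
    ae_restrict_mem measurableSet_Icc] with t ht htT
  have hp₁ := fun K hK => (hfam₁.1 t htT K hK).1
  have hn₁ := fun K hK => (hfam₁.1 t htT K hK).2
  have hp₂ := fun K hK => (hfam₂.1 t htT K hK).1
  have hn₂ := fun K hK => (hfam₂.1 t htT K hK).2
  refine measure_ext_of_integral_comp_signedRoot
    (fun K hK => ENNReal.add_lt_top.2 ⟨hp₁ K hK, hn₂ K hK⟩)
    (fun K hK => ENNReal.add_lt_top.2 ⟨hp₂ K hK, hn₁ K hK⟩) (t / 2) φ hc
    (fun a b hab => (hφ a b hab).1) (fun a b hab => (hφ a b hab).2.1)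
    (fun a b hab => (hφ a b hab).2.2) fun a b hab k => ?_
  have hi : ∀ {m : Measure ℝ}, (∀ K : Set ℝ, IsCompact K → m K < ⊤) →
      Integrable (fun x => φ a b k (signedRoot 0 x - t / 2)) m := fun hm =>
    integrable_comp_signedRoot hm (hc a b k).continuous (hvan a b hab k) _
      le_rfl zero_le_one
  rw [integral_add_measure (hi hp₁) (hi hn₂), integral_add_measure (hi hp₂) (hi hn₁)]
  have := ht a b k hab
  simp only [sint1] at this
  linarith
end
end

section
/- Let b ∈ C(ℝ) satisfy 0 ≤ b(x) ≤ C + C|x| and (b(x+y) − b(x))y ≥ −C|y|² for all x, y ∈ ℝ and some C > 0. Let Z = {x : b(x) = 0}, let ∂Z be its boundary and Z⁰ = Z ∖ ∂Z. Let ν be a nonnegative finite Borel measure on ℝ with ν(Z⁰) = 0 and ∫_{ℝ∖Z⁰} b^{−2} dν < ∞. Then there exists a family of nonnegative finite measures (μ_t)_{t∈[0,T]} solving the Cauchy problem ∂_t μ + ∂_x(b μ) = 0, μ|_{t=0} = ν such that ∫_{ℝ∖Z⁰} b^{−2} dμ_t < ∞ and μ_t(∂Z) = 0 for almost all t ∈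 [0,T]; in particular this solution belongs to the uniqueness class of measures vanishing on ∂Z for almost all t. -/
open MeasureTheory Metric Set Filter
open scoped Topology ENNReal

noncomputable section

/-- The family `(μ_t)_{t∈[0,T]}` of nonnegative Borel measures on `ℝ` is a solution
of the Cauchy problem `∂_t μ + ∂_x (b μ) = 0`, `μ|_{t=0} = ν` on `[0,T]`:
`t ↦ μ_t(B)` is measurable, `t ↦ μ_t(K)` is in `L¹[0,T]` for compact `K`,
`b` is `μ_t dt`-integrable on `U × [0,T]` for every bounded interval `U` and the
weak identity `∫ u(x,t) μ_t(dx) = ∫ u(x,0) ν(dx) + ∫₀ᵗ ∫ [∂_t u + b ∂_x u] μ_s(dx) ds`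
holds for a.e. `t ∈ [0,T]`, for every `C¹` test function `u` vanishing for
`|x| > R` for some `R`. -/
def IsNonnegSolution1 (T : ℝ) (b : ℝ → ℝ) (ν : Measure ℝ) (μ : ℝ → Measure ℝ) : Prop :=
  (∀ B : Set ℝ, MeasurableSet B → Bornology.IsBounded B → Measurable (fun t => μ t B)) ∧
  (∀ t ∈ Icc (0:ℝ) T, ∀ K : Set ℝ, IsCompact K → μ t K < ⊤) ∧
  (∀ K : Set ℝ, IsCompact K → IntegrableOn (fun t => (μ t K).toReal) (Icc (0:ℝ) T)) ∧
  (∀ R : ℝ, 0 < R →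
      (∫⁻ t in Icc (0:ℝ) T, ∫⁻ x in ball (0:ℝ) R, ENNReal.ofReal |b x| ∂(μ t)) < ⊤) ∧
  ∀ u : ℝ → ℝ → ℝ,
    ContDiff ℝ 1 (fun q : ℝ × ℝ => u q.1 q.2) →
    (∃ R > 0, ∀ x t, R < |x| → u x t = 0) →
    ∀ᵐ t ∂(volume.restrict (Icc (0:ℝ) T)),
      (∫ x, u x t ∂(μ t))
        = (∫ x, u x 0 ∂ν)
          + ∫ s in Icc (0:ℝ) t,
              ∫ x, (deriv (u x) s + b x * deriv (fun y => u y s) x) ∂(μ s)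

/-- The points to the left of which `c` is positive. -/
def positiveRay (c : ℝ → ℝ) : Set ℝ := {y | ∀ z ≤ y, 0 < c z}

/-- The time needed to travel from `x` to `y` with speed `c`. -/
def transitTime (c : ℝ → ℝ) (x y : ℝ) : ℝ := ∫ z in x..y, (c z)⁻¹

lemma mem_positiveRay_of_le {c : ℝ → ℝ} {y z : ℝ} (hy : y ∈ positiveRay c) (h : z ≤ y) :
    z ∈ positiveRay c := fun w hw => hy w (hw.trans h)

lemma isOpen_positiveRay {c : ℝ → ℝ} (hc : Continuous c) : IsOpen (positiveRay c) := by
  rw [Metric.isOpen_iff]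
  intro y hy
  obtain ⟨ε, hε, h⟩ := Metric.isOpen_iff.1 (isOpen_lt continuous_const hc) y (hy y le_rfl)
  refine ⟨ε, hε, fun w hw z hz => ?_⟩
  rcases le_total z y with hzy | hzy
  · exact hy z hzy
  · apply h
    rw [Metric.mem_ball, Real.dist_eq] at hw ⊢
    rw [abs_of_nonneg (by linarith)] at hw ⊢
    linarith

lemma convex_positiveRay (c : ℝ → ℝ) : Convex ℝ (positiveRay c) :=
  Set.OrdConnected.convex ⟨fun _ _ _ hy _ hz => mem_positiveRay_of_le hy hz.2⟩

lemma intervalIntegrable_inv_of_mem_positiveRay {c : ℝ → ℝ} (hc : Continuous c) {x y : ℝ}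
    (hx : x ∈ positiveRay c) (hy : y ∈ positiveRay c) :
    IntervalIntegrable (fun z => (c z)⁻¹) volume x y := by
  refine ContinuousOn.intervalIntegrable (hc.continuousOn.inv₀ fun z hz => ?_)
  rcases le_total x y with h | h
  · exact (hy z (by rw [uIcc_of_le h] at hz; exact hz.2)).ne'
  · exact (hx z (by rw [uIcc_of_ge h] at hz; exact hz.2)).ne'

lemma hasDerivAt_transitTime {c : ℝ → ℝ} (hc : Continuous c) {x y : ℝ}
    (hx : x ∈ positiveRay c) (hy : y ∈ positiveRay c) :
    HasDerivAt (transitTime c x) (c y)⁻¹ y :=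
  intervalIntegral.integral_hasDerivAt_right (intervalIntegrable_inv_of_mem_positiveRay hc hx hy)
    hc.measurable.inv.stronglyMeasurable.stronglyMeasurableAtFilter
    (hc.continuousAt.inv₀ (hy y le_rfl).ne')

lemma strictMonoOn_transitTime {c : ℝ → ℝ} (hc : Continuous c) {x : ℝ}
    (hx : x ∈ positiveRay c) : StrictMonoOn (transitTime c x) (positiveRay c) := by
  refine strictMonoOn_of_deriv_pos (convex_positiveRay c)
    (fun y hy => (hasDerivAt_transitTime hc hx hy).continuousAt.continuousWithinAt) fun y hy => ?_
  have hy' := interior_subset hy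
  rw [(hasDerivAt_transitTime hc hx hy').deriv]
  exact inv_pos.2 (hy' y le_rfl)

@[simp] lemma transitTime_self (c : ℝ → ℝ) (x : ℝ) : transitTime c x x = 0 :=
  intervalIntegral.integral_same

/-- A comparison of the speed with an affine function yields a comparison of the transit time with
the logarithm of that function. -/
lemma mul_log_sub_log_le_mul_transitTime {c : ℝ → ℝ} (hc : Continuous c) {x y α β σ K : ℝ}
    (hxy : x ≤ y) (hy : y ∈ positiveRay c)
    (h : ∀ z ∈ Icc x y, σ * β * c z ≤ K * (α + β * z)) (hpos : ∀ z ∈ Icc x y, 0 < α + β * z) :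
    σ * (Real.log (α + β * y) - Real.log (α + β * x)) ≤ K * transitTime c x y := by
  have hx := mem_positiveRay_of_le hy hxy
  have hd : ∀ z ∈ Icc x y, HasDerivAt
      (fun z => K * transitTime c x z - σ * Real.log (α + β * z))
      (K * (c z)⁻¹ - σ * (β / (α + β * z))) z := by
    intro z hz
    have h1 := (hasDerivAt_transitTime hc hx (mem_positiveRay_of_le hy hz.2)).const_mul K
    have h2 : HasDerivAt (fun z => α + β * z) β z := by
      simpa using ((hasDerivAt_id z).const_mul β).const_add α
    exact h1.sub ((h2.log (hpos z hz).ne').const_mul σ)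
  have hm : MonotoneOn (fun z => K * transitTime c x z - σ * Real.log (α + β * z))
      (Icc x y) := by
    refine monotoneOn_of_deriv_nonneg (convex_Icc x y)
      (fun z hz => (hd z hz).continuousAt.continuousWithinAt)
      (fun z hz => (hd z (interior_subset hz)).differentiableAt.differentiableWithinAt)
      fun z hz => ?_
    have hz := interior_subset hz
    rw [(hd z hz).deriv, ← div_eq_mul_inv, ← mul_div_assoc, sub_nonneg,
      div_le_div_iff₀ (hpos z hz) (hy z hz.2)]
    exact h z hz
  have := hm (left_mem_Icc.2 hxy) (right_mem_Icc.2 hxy) hxy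
  simp only [transitTime_self] at this
  linarith

lemma mul_exp_le_of_transitTime_le {c : ℝ → ℝ} (hc : Continuous c) {x y C t : ℝ}
    (hC : 0 < C) (hosl : ∀ w z, w ≤ z → c w - C * (z - w) ≤ c z)
    (hxy : x ≤ y) (hy : y ∈ positiveRay c) (ht : transitTime c x y ≤ t) :
    c x * Real.exp (-(C * t)) ≤ c y := by
  have hcx := hy x hxy
  have hcy := hy y le_rfl
  have key := mul_log_sub_log_le_mul_transitTime (α := c y + C * y) (β := -C) (σ := -1) (K := C)
    hc hxy hy (fun z hz => by nlinarith [hosl z y hz.2])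
    (fun z hz => by nlinarith [mul_nonneg hC.le (sub_nonneg.2 hz.2)])
  have h1 : c y + C * y + -C * y = c y := by ring
  have h2 : Real.log (c x) ≤ Real.log (c y + C * y + -C * x) :=
    Real.log_le_log hcx (by linarith [hosl x y hxy])
  rw [h1] at key
  rw [← Real.log_le_log_iff (by positivity) hcy, Real.log_mul hcx.ne' (Real.exp_pos _).ne',
    Real.log_exp]
  nlinarith [mul_le_mul_of_nonneg_left ht hC.le]

lemma add_sub_le_mul_exp_of_transitTime_le {c : ℝ → ℝ} (hc : Continuous c) {x y A C t : ℝ}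
    (hC : 0 < C) (hA : 0 < A) (hgrowth : ∀ z, x ≤ z → c z ≤ C * (A + (z - x)))
    (hxy : x ≤ y) (hy : y ∈ positiveRay c) (ht : transitTime c x y ≤ t) :
    A + (y - x) ≤ A * Real.exp (C * t) := by
  have key := mul_log_sub_log_le_mul_transitTime (α := A - x) (β := 1) (σ := 1) (K := C)
    hc hxy hy (fun z hz => by linarith [hgrowth z hz.1]) (fun z hz => by linarith [hz.1])
  have h1 : A - x + 1 * y = A + (y - x) := by ring
  have h2 : A - x + 1 * x = A := by ring
  rw [h1, h2] at key
  rw [← Real.log_le_log_iff (by linarith) (by positivity), Real.log_mul hA.ne'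
    (Real.exp_pos _).ne', Real.log_exp]
  nlinarith [mul_le_mul_of_nonneg_left ht hC.le]

lemma exists_transitTime_eq {c : ℝ → ℝ} (hc : Continuous c) {x A C t : ℝ}
    (hC : 0 < C) (hA : 0 < A) (hx : x ∈ positiveRay c)
    (hosl : ∀ w z, w ≤ z → c w - C * (z - w) ≤ c z)
    (hgrowth : ∀ z, x ≤ z → c z ≤ C * (A + (z - x))) (ht : 0 ≤ t) :
    ∃ y, x ≤ y ∧ y ∈ positiveRay c ∧ transitTime c x y = t := by
  set S : Set ℝ := {y | x ≤ y ∧ y ∈ positiveRay c ∧ transitTime c x y ≤ t} with hS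
  have hxS : x ∈ S := ⟨le_rfl, hx, by simpa using ht⟩
  have hbdd : BddAbove S := ⟨A * Real.exp (C * t) - A + x, fun y hy => by
    linarith [add_sub_le_mul_exp_of_transitTime_le hc hC hA hgrowth hy.1 hy.2.1 hy.2.2]⟩
  set s := sSup S with hs
  have hxs : x ≤ s := le_csSup hbdd hxS
  have hcl : s ∈ closure S := csSup_mem_closure ⟨x, hxS⟩ hbdd
  have hcs : 0 < c s := by
    have hsub : S ⊆ {y | c x * Real.exp (-(C * t)) ≤ c y} := fun y hy =>
      mul_exp_le_of_transitTime_le hc hC hosl hy.1 hy.2.1 hy.2.2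
    have := closure_minimal hsub (isClosed_le continuous_const hc) hcl
    exact lt_of_lt_of_le (mul_pos (hx x le_rfl) (Real.exp_pos _)) this
  have hsI : s ∈ positiveRay c := by
    intro z hz
    rcases hz.lt_or_eq with hz | rfl
    · obtain ⟨y, hy, hzy⟩ := exists_lt_of_lt_csSup ⟨x, hxS⟩ hz
      exact hy.2.1 z hzy.le
    · exact hcs
  have hcont : ContinuousAt (transitTime c x) s := (hasDerivAt_transitTime hc hx hsI).continuousAt
  refine ⟨s, hxs, hsI, le_antisymm ?_ ?_⟩
  · obtain ⟨u, hu, hus⟩ := mem_closure_iff_seq_limit.1 hcl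
    exact le_of_tendsto (hcont.tendsto.comp hus) (Eventually.of_forall fun n => (hu n).2.2)
  · by_contra! hlt
    have h1 : ∀ᶠ y in 𝓝[>] s, transitTime c x y < t :=
      (hcont.eventually (gt_mem_nhds hlt)).filter_mono nhdsWithin_le_nhds
    have h2 : ∀ᶠ y in 𝓝[>] s, y ∈ positiveRay c :=
      ((isOpen_positiveRay hc).eventually_mem hsI).filter_mono nhdsWithin_le_nhds
    obtain ⟨y, ⟨hy1, hy2⟩, hy3⟩ := ((h1.and h2).and self_mem_nhdsWithin).exists
    exact absurd (le_csSup hbdd ⟨hxs.trans (le_of_lt hy3), hy2, hy1.le⟩) (not_le.2 hy3)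

lemma transitTime_surjective {c : ℝ → ℝ} (hc : Continuous c) {x A C : ℝ}
    (hC : 0 < C) (hA : 0 < A) (hx : 0 < c x) (hconst : ∀ z ≤ x, c z = c x)
    (hosl : ∀ w z, w ≤ z → c w - C * (z - w) ≤ c z)
    (hgrowth : ∀ z, x ≤ z → c z ≤ C * (A + (z - x))) (t : ℝ) :
    ∃ y ∈ positiveRay c, transitTime c x y = t := by
  have hxI : x ∈ positiveRay c := fun z hz => (hconst z hz).symm ▸ hx
  rcases le_total 0 t with ht | ht
  · obtain ⟨y, -, h⟩ := exists_transitTime_eq hc hC hA hxI hosl hgrowth ht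
    exact ⟨y, h⟩
  · have hle : x + t * c x ≤ x := by nlinarith
    refine ⟨x + t * c x, mem_positiveRay_of_le hxI hle, ?_⟩
    have : transitTime c x (x + t * c x) = ∫ _ in x..(x + t * c x), (c x)⁻¹ := by
      refine intervalIntegral.integral_congr fun z hz => ?_
      rw [uIcc_of_ge hle] at hz
      simp only [hconst z hz.2]
    rw [this, intervalIntegral.integral_const, smul_eq_mul]
    field_simp
    ring

/-- A right inverse of the transit time is an integral curve. -/
lemma hasDerivAt_of_transitTime_eq {c : ℝ → ℝ} (hc : Continuous c) {x : ℝ}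
    (hx : x ∈ positiveRay c) {γ : ℝ → ℝ} (hγ : ∀ t, γ t ∈ positiveRay c)
    (hγt : ∀ t, transitTime c x (γ t) = t) (t : ℝ) : HasDerivAt γ (c (γ t)) t := by
  have hmono := strictMonoOn_transitTime hc hx
  have hγm : StrictMono γ := fun s t hst => by
    rwa [← hmono.lt_iff_lt (hγ s) (hγ t), hγt, hγt]
  have hcont : ContinuousAt γ t := by
    refine (hγm.strictMonoOn univ).continuousAt_of_image_mem_nhds univ_mem ?_
    refine mem_of_superset ((isOpen_positiveRay hc).mem_nhds (hγ t)) fun y hy => ?_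
    exact ⟨transitTime c x y, mem_univ _, hmono.injOn (hγ _) hy (hγt _)⟩
  have hpos : 0 < c (γ t) := hγ t _ le_rfl
  simpa using HasDerivAt.of_local_left_inverse hcont (hasDerivAt_transitTime hc hx (hγ t))
    (inv_ne_zero hpos.ne') (Eventually.of_forall hγt)

/-- A nonnegative velocity field of at most linear growth which decreases at most at rate `C`. -/
structure IsOneSidedSpeed (b : ℝ → ℝ) (C : ℝ) : Prop where
  continuous : Continuous b
  pos : 0 < C
  osl : ∀ w z, w ≤ z → b w - C * (z - w) ≤ b z
  growth : ∀ x, b x ≤ C + C * |x|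

open Classical in
/-- The position at time `t` of the particle that starts from `x` and moves with velocity `b`,
if `0 < b x`; other particles do not move. -/
def flow (b : ℝ → ℝ) (t x : ℝ) : ℝ :=
  if h : 0 < b x ∧ ∃ y ∈ positiveRay (fun z => b (max x z)),
    transitTime (fun z => b (max x z)) x y = t then h.2.choose else x

namespace IsOneSidedSpeed

variable {b : ℝ → ℝ} {C : ℝ}

lemma continuous_max (hb : IsOneSidedSpeed b C) (x : ℝ) : Continuous fun z => b (max x z) :=
  hb.continuous.comp (continuous_const.max continuous_id)

lemma osl_max (hb : IsOneSidedSpeed b C) (x w z : ℝ) (hwz : w ≤ z) :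
    b (max x w) - C * (z - w) ≤ b (max x z) := by
  have h1 := hb.osl (max x w) (max x z) (max_le_max le_rfl hwz)
  have h2 : max x z - max x w ≤ z - w := by
    rcases max_cases x z with h | h <;> rcases max_cases x w with h' | h' <;> linarith
  nlinarith [mul_le_mul_of_nonneg_left h2 hb.pos.le]

lemma growth_max (hb : IsOneSidedSpeed b C) (x z : ℝ) (hxz : x ≤ z) :
    b (max x z) ≤ C * (1 + |x| + (z - x)) := by
  rw [max_eq_right hxz]
  have h : |z| ≤ |x| + (z - x) := by
    have := abs_add_le x (z - x)
    rwa [add_sub_cancel, abs_of_nonneg (sub_nonneg.2 hxz)] at this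
  nlinarith [hb.growth z, mul_le_mul_of_nonneg_left h hb.pos.le]

lemma self_mem_positiveRay {x : ℝ} (hx : 0 < b x) : x ∈ positiveRay fun z => b (max x z) :=
  fun z hz => by simpa only [max_eq_left hz] using hx

lemma flow_spec (hb : IsOneSidedSpeed b C) {x : ℝ} (hx : 0 < b x) (t : ℝ) :
    flow b t x ∈ positiveRay (fun z => b (max x z)) ∧
      transitTime (fun z => b (max x z)) x (flow b t x) = t := by
  have h := transitTime_surjective (x := x) (A := 1 + |x|) (hb.continuous_max x) hb.pos
    (by positivity) (by simpa using hx) (fun z hz => by simp [max_eq_left hz]) (hb.osl_max x)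
    (hb.growth_max x) t
  rw [flow, dif_pos ⟨hx, h⟩]
  exact h.choose_spec

lemma flow_eq_self {x : ℝ} (hx : ¬ 0 < b x) (t : ℝ) : flow b t x = x :=
  dif_neg fun h => hx h.1

lemma flow_zero (hb : IsOneSidedSpeed b C) (x : ℝ) : flow b 0 x = x := by
  by_cases hx : 0 < b x
  · have hxI := self_mem_positiveRay hx
    exact (strictMonoOn_transitTime (hb.continuous_max x) hxI).injOn (hb.flow_spec hx 0).1 hxI
      (by rw [(hb.flow_spec hx 0).2, transitTime_self])
  · exact flow_eq_self hx 0

lemma le_flow (hb : IsOneSidedSpeed b C) {x t : ℝ} (hx : 0 < b x) (ht : 0 ≤ t) :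
    x ≤ flow b t x := by
  have hxI := self_mem_positiveRay hx
  rw [← (strictMonoOn_transitTime (hb.continuous_max x) hxI).le_iff_le hxI (hb.flow_spec hx t).1,
    transitTime_self, (hb.flow_spec hx t).2]
  exact ht

lemma hasDerivAt_flow_max (hb : IsOneSidedSpeed b C) {x : ℝ} (hx : 0 < b x) (t : ℝ) :
    HasDerivAt (fun s => flow b s x) (b (max x (flow b t x))) t :=
  hasDerivAt_of_transitTime_eq (hb.continuous_max x) (self_mem_positiveRay hx)
    (fun t => (hb.flow_spec hx t).1) (fun t => (hb.flow_spec hx t).2) t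

lemma hasDerivAt_flow (hb : IsOneSidedSpeed b C) {x t : ℝ} (hx : 0 < b x) (ht : 0 ≤ t) :
    HasDerivAt (fun s => flow b s x) (b (flow b t x)) t := by
  have := hb.hasDerivAt_flow_max hx t
  rwa [max_eq_right (hb.le_flow hx ht)] at this

lemma continuous_flow (hb : IsOneSidedSpeed b C) (x : ℝ) : Continuous fun t => flow b t x := by
  by_cases hx : 0 < b x
  · exact continuous_iff_continuousAt.2 fun t => (hb.hasDerivAt_flow_max hx t).continuousAt
  · simpa only [flow_eq_self hx] using continuous_const

lemma mul_exp_le_flow (hb : IsOneSidedSpeed b C) {x t : ℝ} (hx : 0 < b x) (ht : 0 ≤ t) :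
    b x * Real.exp (-(C * t)) ≤ b (flow b t x) := by
  have hle := hb.le_flow hx ht
  simpa [max_eq_right hle] using mul_exp_le_of_transitTime_le (hb.continuous_max x) hb.pos
    (hb.osl_max x) hle (hb.flow_spec hx t).1 (hb.flow_spec hx t).2.le

lemma flow_pos (hb : IsOneSidedSpeed b C) {x t : ℝ} (hx : 0 < b x) (ht : 0 ≤ t) :
    0 < b (flow b t x) :=
  (mul_pos hx (Real.exp_pos _)).trans_le (hb.mul_exp_le_flow hx ht)

lemma monotoneOn_flow (hb : IsOneSidedSpeed b C) {t : ℝ} (ht : 0 ≤ t) :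
    MonotoneOn (flow b t) {x | 0 < b x} := by
  intro x hx x' hx' hxx'
  rcases le_total (flow b t x) x' with h | h
  · exact h.trans (hb.le_flow hx' ht)
  set y := flow b t x with hy
  obtain ⟨hyI, hyt⟩ := hb.flow_spec hx t
  have hx'I := self_mem_positiveRay hx'
  have hyI' : y ∈ positiveRay fun z => b (max x' z) := fun z hz => by
    have := hyI (max x' z) (max_le h hz)
    simpa only [max_eq_right (hxx'.trans (le_max_left _ _))] using this
  rw [← (strictMonoOn_transitTime (hb.continuous_max x') hx'I).le_iff_le hyI'
    (hb.flow_spec hx' t).1, (hb.flow_spec hx' t).2]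
  have hx'J : x' ∈ positiveRay fun z => b (max x z) := mem_positiveRay_of_le hyI h
  have hxI := self_mem_positiveRay hx
  have hcx := hb.continuous_max x
  have h1 : transitTime (fun z => b (max x' z)) x' y = ∫ z in x'..y, (b (max x z))⁻¹ := by
    refine intervalIntegral.integral_congr fun z hz => ?_
    rw [uIcc_of_le h] at hz
    simp only [max_eq_right hz.1, max_eq_right (hxx'.trans hz.1)]
  have h2 : transitTime (fun z => b (max x z)) x x' + ∫ z in x'..y, (b (max x z))⁻¹ = t := by
    rw [← hyt]
    exact intervalIntegral.integral_add_adjacent_intervals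
      (intervalIntegrable_inv_of_mem_positiveRay hcx hxI hx'J)
      (intervalIntegrable_inv_of_mem_positiveRay hcx hx'J hyI)
  have h3 := (strictMonoOn_transitTime hcx hxI).monotoneOn hxI hx'J hxx'
  rw [transitTime_self] at h3
  linarith

lemma measurable_flow (hb : IsOneSidedSpeed b C) {t : ℝ} (ht : 0 ≤ t) : Measurable (flow b t) := by
  have hm : MeasurableSet {x | 0 < b x} := measurableSet_lt measurable_const hb.continuous.measurable
  refine measurable_of_restrict_of_restrict_compl hm ?_ ?_
  · exact Monotone.measurable fun x y hxy => hb.monotoneOn_flow ht x.2 y.2 hxy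
  · have : ({x | 0 < b x}ᶜ : Set ℝ).domRestrict (flow b t) = Subtype.val :=
      funext fun x => flow_eq_self x.2 t
    rw [this]
    exact measurable_subtype_coe

lemma measurable_uncurry_flow (hb : IsOneSidedSpeed b C) :
    Measurable (Function.uncurry fun t x => flow b (max t 0) x) :=
  measurable_uncurry_of_continuous_of_measurable
    (fun x => (hb.continuous_flow x).comp (continuous_id.max continuous_const))
    fun _ => hb.measurable_flow (le_max_right _ _)

end IsOneSidedSpeed

/-- The derivative of a test function along the velocity field `b`. -/
lemma deriv_add_mul_deriv_eq_fderiv {u : ℝ → ℝ → ℝ} {x s : ℝ} (v : ℝ)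
    (hu : DifferentiableAt ℝ (fun q : ℝ × ℝ => u q.1 q.2) (x, s)) :
    deriv (u x) s + v * deriv (fun y => u y s) x
      = fderiv ℝ (fun q : ℝ × ℝ => u q.1 q.2) (x, s) (v, 1) := by
  have h1 : HasDerivAt (u x) (fderiv ℝ (fun q : ℝ × ℝ => u q.1 q.2) (x, s) (0, 1)) s :=
    HasFDerivAt.comp_hasDerivAt (f := fun s => (x, s)) s hu.hasFDerivAt
      ((hasDerivAt_const s x).prodMk (hasDerivAt_id s))
  have h2 : HasDerivAt (fun y => u y s)
      (fderiv ℝ (fun q : ℝ × ℝ => u q.1 q.2) (x, s) (1, 0)) x :=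
    HasFDerivAt.comp_hasDerivAt (f := fun y => (y, s)) x hu.hasFDerivAt
      ((hasDerivAt_id x).prodMk (hasDerivAt_const x s))
  rw [h1.deriv, h2.deriv, ← smul_eq_mul, ← map_smul, ← map_add]
  simp

/-- The push-forward of a measure along integral curves of `b` satisfies the weak form of the
continuity equation. -/
lemma integral_map_eq_add_integral_of_hasDerivAt {b : ℝ → ℝ} (hb : Continuous b)
    {ν : Measure ℝ} [IsFiniteMeasure ν] {Φ : ℝ → ℝ → ℝ} (hΦ : Measurable (Function.uncurry Φ))
    (hΦ0 : ∀ᵐ x ∂ν, Φ 0 x = x) (hΦc : ∀ᵐ x ∂ν, Continuous fun t => Φ t x)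
    (hΦd : ∀ᵐ x ∂ν, ∀ t, 0 < t → HasDerivAt (fun s => Φ s x) (b (Φ t x)) t)
    {u : ℝ → ℝ → ℝ} (hu : ContDiff ℝ 1 (fun q : ℝ × ℝ => u q.1 q.2))
    (hsupp : ∃ R > 0, ∀ x t, R < |x| → u x t = 0) {t : ℝ} (ht : 0 ≤ t) :
    ∫ x, u x t ∂(ν.map (Φ t)) = ∫ x, u x 0 ∂ν + ∫ s in Icc (0 : ℝ) t,
      ∫ x, (deriv (u x) s + b x * deriv (fun y => u y s) x) ∂(ν.map (Φ s)) := by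
  obtain ⟨R, -, hR⟩ := hsupp
  set U : ℝ × ℝ → ℝ := fun q => u q.1 q.2 with hU
  set g : ℝ × ℝ → ℝ := fun q => fderiv ℝ U q (b q.1, 1) with hg
  have hUd : Differentiable ℝ U := hu.differentiable one_ne_zero
  have hgc : Continuous g := (hu.continuous_fderiv one_ne_zero).clm_apply
    ((hb.comp continuous_fst).prodMk continuous_const)
  have hU0 : ∀ q : ℝ × ℝ, R < |q.1| → U q = 0 := fun q hq => hR q.1 q.2 hq
  have hg0 : ∀ q : ℝ × ℝ, R < |q.1| → g q = 0 := by
    intro q hq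
    have : U =ᶠ[𝓝 q] fun _ => 0 := by
      filter_upwards [(isOpen_lt continuous_const (continuous_fst.abs)).mem_nhds hq] with p hp
      exact hU0 p hp
    simp [hg, this.fderiv_eq]
  have hbound : ∀ f : ℝ × ℝ → ℝ, Continuous f → (∀ q : ℝ × ℝ, R < |q.1| → f q = 0) →
      ∃ M, ∀ x, ∀ s ∈ Icc 0 t, ‖f (x, s)‖ ≤ M := by
    intro f hf hf0
    obtain ⟨M, hM⟩ := ((isCompact_Icc (a := -R) (b := R)).prod
      (isCompact_Icc (a := (0 : ℝ)) (b := t))).exists_bound_of_continuousOn hf.continuousOn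
    refine ⟨max M 0, fun x s hs => ?_⟩
    by_cases hx : R < |x|
    · simp [hf0 (x, s) hx]
    · exact (hM (x, s) ⟨abs_le.1 (not_lt.1 hx), hs⟩).trans (le_max_left _ _)
  obtain ⟨M, hM⟩ := hbound g hgc hg0
  obtain ⟨N, hN⟩ := hbound U hu.continuous hU0
  have hΦt : ∀ s, Measurable (Φ s) := fun s => hΦ.of_uncurry_left
  have hinner : ∀ s, ∫ x, (deriv (u x) s + b x * deriv (fun y => u y s) x) ∂(ν.map (Φ s))
      = ∫ x, g (Φ s x, s) ∂ν := by
    intro s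
    rw [← integral_map (f := fun x => g (x, s)) (hΦt s).aemeasurable
      (hgc.comp (by fun_prop : Continuous fun x : ℝ => (x, s))).aestronglyMeasurable]
    refine integral_congr_ae (Eventually.of_forall fun x => ?_)
    exact deriv_add_mul_deriv_eq_fderiv (b x) (hUd (x, s))
  have houter : ∫ x, u x t ∂(ν.map (Φ t)) = ∫ x, u (Φ t x) t ∂ν :=
    integral_map (hΦt t).aemeasurable
      (hu.continuous.comp (by fun_prop : Continuous fun x : ℝ => (x, t))).aestronglyMeasurable
  have hgint : Integrable (Function.uncurry fun s x => g (Φ s x, s))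
      ((volume.restrict (Icc (0 : ℝ) t)).prod ν) := by
    refine Integrable.mono' (integrable_const M)
      (hgc.measurable.comp (hΦ.prodMk measurable_fst)).aestronglyMeasurable ?_
    have : ∀ᵐ p ∂((volume.restrict (Icc (0 : ℝ) t)).prod ν), p.1 ∈ Icc (0 : ℝ) t :=
      Measure.quasiMeasurePreserving_fst.ae (ae_restrict_mem measurableSet_Icc)
    filter_upwards [this] with p hp
    exact hM _ _ hp
  have hUint : ∀ s ∈ Icc 0 t, Integrable (fun x => u (Φ s x) s) ν := fun s hs =>
    Integrable.mono' (integrable_const N)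
      (hu.continuous.measurable.comp ((hΦt s).prodMk measurable_const)).aestronglyMeasurable
      (Eventually.of_forall fun x => hN _ _ hs)
  have hUint0 : Integrable (fun x => u x 0) ν :=
    (hUint 0 ⟨le_rfl, ht⟩).congr (hΦ0.mono fun x hx => by simp only [hx])
  simp_rw [hinner]
  rw [houter, integral_integral_swap hgint, ← sub_eq_iff_eq_add',
    ← integral_sub (hUint t ⟨ht, le_rfl⟩) hUint0]
  refine integral_congr_ae ?_
  filter_upwards [hΦ0, hΦc, hΦd] with x h0 hc hd
  have hcurve : Continuous fun s => (Φ s x, s) := hc.prodMk continuous_id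
  have hFTC := intervalIntegral.integral_eq_sub_of_hasDerivAt_of_le (f := fun s => U (Φ s x, s))
    (f' := fun s => g (Φ s x, s)) ht (hu.continuous.comp hcurve).continuousOn
    (fun s hs => HasFDerivAt.comp_hasDerivAt (f := fun s => (Φ s x, s)) s (hUd _).hasFDerivAt
      ((hd s hs.1).prodMk (hasDerivAt_id s)))
    ((hgc.comp hcurve).intervalIntegrable _ _)
  rw [integral_Icc_eq_integral_Ioc, ← intervalIntegral.integral_of_le ht, hFTC]
  simp only [hU, h0]

/-- A measure with finite integral of `b⁻²` off the interior of the zero set, and no mass in that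
interior, is concentrated on the set where `b` is positive. -/
lemma ae_pos_of_lintegral_inv_sq_lt_top {b : ℝ → ℝ} (hb : Measurable b) (hb0 : ∀ x, 0 ≤ b x)
    {ν : Measure ℝ} {s : Set ℝ} (hs : MeasurableSet s) (hνs : ν s = 0)
    (hν : ∫⁻ x in sᶜ, (ENNReal.ofReal ((b x) ^ 2))⁻¹ ∂ν < ⊤) : ∀ᵐ x ∂ν, 0 < b x := by
  have h1 := ae_lt_top (hb.pow_const 2).ennreal_ofReal.inv hν.ne
  rw [ae_restrict_iff' hs.compl] at h1
  filter_upwards [h1, measure_eq_zero_iff_ae_notMem.1 hνs] with x hx hxs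
  refine (hb0 x).lt_of_ne fun h => ?_
  simpa [← h] using hx hxs

/-- **Existence in the uniqueness class (dimension one).** Let `b ∈ C(ℝ)` with
`0 ≤ b(x) ≤ C + C|x|` and `(b(x+y) - b(x))y ≥ -C y²`.  Let `Z = {x : b(x) = 0}`,
`Z⁰ = Z ∖ ∂Z`, and let `ν` be a nonnegative finite measure with `ν(Z⁰) = 0` and
`∫_{ℝ∖Z⁰} b⁻² dν < ∞`.  Then there is a family of nonnegative finite measures
`(μ_t)_{t∈[0,T]}` solving `∂_t μ + ∂_x(b μ) = 0`, `μ|_{t=0} = ν` with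
`∫_{ℝ∖Z⁰} b⁻² dμ_t < ∞` and `μ_t(∂Z) = 0` for a.e. `t ∈ [0,T]`, i.e. a solution
in the uniqueness class of measures vanishing on `∂Z`. -/
theorem existence_in_uniqueness_class_dim_one
    (T : ℝ) (hT : 0 < T)
    (b : ℝ → ℝ) (hb : Continuous b)
    (C : ℝ) (hC : 0 < C)
    (hb0 : ∀ x, 0 ≤ b x) (hgrowth : ∀ x, b x ≤ C + C * |x|)
    (hosl : ∀ x y : ℝ, (b (x + y) - b x) * y ≥ -C * y ^ 2)
    (ν : Measure ℝ) [IsFiniteMeasure ν]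
    (hνZ0 : ν ({x : ℝ | b x = 0} \ frontier {x : ℝ | b x = 0}) = 0)
    (hνint : ∫⁻ x in ({x : ℝ | b x = 0} \ frontier {x : ℝ | b x = 0})ᶜ,
        (ENNReal.ofReal ((b x) ^ 2))⁻¹ ∂ν < ⊤) :
    ∃ μ : ℝ → Measure ℝ,
      (∀ t ∈ Icc (0:ℝ) T, μ t univ < ⊤) ∧
      IsNonnegSolution1 T b ν μ ∧
      ∀ᵐ t ∂(volume.restrict (Icc (0:ℝ) T)),
        (∫⁻ x in ({x : ℝ | b x = 0} \ frontier {x : ℝ | b x = 0})ᶜ,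
            (ENNReal.ofReal ((b x) ^ 2))⁻¹ ∂(μ t) < ⊤) ∧
        μ t (frontier {x : ℝ | b x = 0}) = 0 := by
  have hspeed : IsOneSidedSpeed b C := by
    refine ⟨hb, hC, fun w z hwz => ?_, hgrowth⟩
    rcases hwz.lt_or_eq with h | rfl
    · have := hosl w (z - w)
      rw [add_sub_cancel] at this
      nlinarith [sub_pos.2 h]
    · simp
  have hZ : IsClosed {x : ℝ | b x = 0} := isClosed_eq hb continuous_const
  have hZ0 : MeasurableSet ({x : ℝ | b x = 0} \ frontier {x : ℝ | b x = 0}) :=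
    hZ.measurableSet.diff isClosed_frontier.measurableSet
  have hpos := ae_pos_of_lintegral_inv_sq_lt_top hb.measurable hb0 hZ0 hνZ0 hνint
  have hΦ := hspeed.measurable_uncurry_flow
  set Φ : ℝ → ℝ → ℝ := fun t x => flow b (max t 0) x with hΦdef
  have hΦt : ∀ t, Measurable (Φ t) := fun t => hΦ.of_uncurry_left
  have hmeas : ∀ B, MeasurableSet B → Measurable fun t => ν.map (Φ t) B := by
    intro B hB
    have h : (fun t => ν.map (Φ t) B) = fun t => ν (Prod.mk t ⁻¹' (Function.uncurry Φ ⁻¹' B)) :=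
      funext fun t => Measure.map_apply (hΦt t) hB
    rw [h]
    exact measurable_measure_prodMk_left (hΦ hB)
  have hle : ∀ t B, ν.map (Φ t) B ≤ ν univ := fun t B =>
    (measure_mono (subset_univ B)).trans_eq (by rw [Measure.map_apply (hΦt t) .univ, preimage_univ])
  refine ⟨fun t => ν.map (Φ t), fun t _ => measure_lt_top _ _,
    ⟨fun B hB _ => hmeas B hB, fun t _ K _ => measure_lt_top _ _, fun K hK => ?_,
      fun R hR => ?_, fun u hu hsupp => ?_⟩, ?_⟩
  · refine Integrable.mono' (integrable_const (ν univ).toReal)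
      (hmeas K hK.measurableSet).ennreal_toReal.aestronglyMeasurable
      (Eventually.of_forall fun t => ?_)
    rw [Real.norm_of_nonneg ENNReal.toReal_nonneg]
    exact ENNReal.toReal_mono (measure_ne_top _ _) (hle t K)
  · have hbd : ∀ t, ∫⁻ x in ball (0 : ℝ) R, ENNReal.ofReal |b x| ∂(ν.map (Φ t))
        ≤ ENNReal.ofReal (C + C * R) * ν univ := by
      intro t
      calc ∫⁻ x in ball (0 : ℝ) R, ENNReal.ofReal |b x| ∂(ν.map (Φ t))
          ≤ ∫⁻ _ in ball (0 : ℝ) R, ENNReal.ofReal (C + C * R) ∂(ν.map (Φ t)) := by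
            refine setLIntegral_mono measurable_const fun x hx => ENNReal.ofReal_le_ofReal ?_
            rw [abs_of_nonneg (hb0 x)]
            rw [mem_ball_zero_iff, Real.norm_eq_abs] at hx
            exact (hgrowth x).trans (by gcongr)
        _ ≤ ENNReal.ofReal (C + C * R) * ν univ := by
            rw [setLIntegral_const]
            exact mul_le_mul' le_rfl (hle t _)
    refine (lintegral_mono hbd).trans_lt ?_
    rw [setLIntegral_const]
    exact ENNReal.mul_lt_top (ENNReal.mul_lt_top ENNReal.ofReal_lt_top (measure_lt_top _ _))
      measure_Icc_lt_top
  · refine (ae_restrict_mem measurableSet_Icc).mono fun t ht => ?_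
    refine integral_map_eq_add_integral_of_hasDerivAt hb hΦ (Eventually.of_forall fun x => ?_)
      (Eventually.of_forall fun x => ?_) ?_ hu hsupp ht.1
    · simp [hΦdef, hspeed.flow_zero]
    · exact (hspeed.continuous_flow x).comp (continuous_id.max continuous_const)
    · filter_upwards [hpos] with x hx t ht
      have h := hspeed.hasDerivAt_flow hx ht.le
      rw [show Φ t x = flow b t x by simp [hΦdef, max_eq_left ht.le]]
      refine h.congr_of_eventuallyEq ?_
      filter_upwards [lt_mem_nhds ht] with s hs
      simp [hΦdef, max_eq_left hs.le]
  · refine Eventually.of_forall fun t => ⟨?_, ?_⟩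
    · set E := ENNReal.ofReal ((Real.exp (-(C * max t 0))) ^ 2) with hE
      have hE0 : E ≠ 0 := (ENNReal.ofReal_pos.2 (by positivity)).ne'
      have hm : Measurable fun x => (ENNReal.ofReal ((b x) ^ 2))⁻¹ :=
        (hb.measurable.pow_const 2).ennreal_ofReal.inv
      calc ∫⁻ x in ({x : ℝ | b x = 0} \ frontier {x : ℝ | b x = 0})ᶜ,
            (ENNReal.ofReal ((b x) ^ 2))⁻¹ ∂(ν.map (Φ t))
          ≤ ∫⁻ x, (ENNReal.ofReal ((b x) ^ 2))⁻¹ ∂(ν.map (Φ t)) := setLIntegral_le_lintegral _ _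
        _ = ∫⁻ x, (ENNReal.ofReal ((b (Φ t x)) ^ 2))⁻¹ ∂ν := lintegral_map hm (hΦt t)
        _ ≤ ∫⁻ x, E⁻¹ * (ENNReal.ofReal ((b x) ^ 2))⁻¹ ∂ν := by
            refine lintegral_mono_ae ?_
            filter_upwards [hpos] with x hx
            rw [← ENNReal.mul_inv (Or.inl hE0) (Or.inl ENNReal.ofReal_ne_top), hE,
              ← ENNReal.ofReal_mul (by positivity), ← mul_pow, mul_comm (Real.exp _)]
            refine ENNReal.inv_le_inv.2 (ENNReal.ofReal_le_ofReal ?_)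
            exact pow_le_pow_left₀ (by positivity)
              (hspeed.mul_exp_le_flow hx (le_max_right t 0)) 2
        _ = E⁻¹ * ∫⁻ x in ({x : ℝ | b x = 0} \ frontier {x : ℝ | b x = 0})ᶜ,
              (ENNReal.ofReal ((b x) ^ 2))⁻¹ ∂ν := by
            rw [lintegral_const_mul _ hm, Measure.restrict_eq_self_of_ae_mem]
            exact measure_eq_zero_iff_ae_notMem.1 hνZ0
        _ < ⊤ := ENNReal.mul_lt_top (ENNReal.inv_lt_top.2 (pos_iff_ne_zero.2 hE0)) hνint
    · rw [Measure.map_apply (hΦt t) isClosed_frontier.measurableSet,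
        measure_eq_zero_iff_ae_notMem]
      filter_upwards [hpos] with x hx hmem
      exact (hspeed.flow_pos hx (le_max_right t 0)).ne' (hZ.frontier_subset hmem)
end
end
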